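/- Let n ≥ 2 be the number of tokens, let ε > 0, C_K > 0, C_V > 0, and let N ∈ ℕ. Consider a sequence of training examples (u_k, v_k, a_k) ∈ (Fin n)³ for k = 0, …, N−1, key-query matrices W_k with |e_{u_k}^T W_k e_{v_k}| ≤ C_K/2 and |e_{v_k}^T W_k e_{v_k}| ≤ C_K/2, attention weights (α_k, β_k) = σ((e_{u_k}^T W_k e_{v_k}, e_{v_k}^T W_k e_{v_k})), outputs f_k = σ(α_k V_k e_{u_k} + β_k V_k e_{v_k}), and value matrices V_0 = 0, V_{k+1} = V_k + ε (α_k (e_{a_k} − f_k) e_{u_k}^T + β_k (e_{a_k} − f_k) e_{v_k}^T), with ‖V_k e_t‖_∞ ≤ C_V/2 for all 0 ≤ k ≤ N and all tokens t. Fix distinct tokens s, r, a such that s ≠ v_k and s ≠ a_k for all k, and such that a_k = a for every k with (u_k, v_k) = (s, r). Let m = #{k : (u_k, v_k) = (s, r)} ≥ 1 and n_tot = #{k : u_k = s}. If n_tot < m · exp(−C_K) (n − 1) / (2 exp(C_V)), then the fact salience after training is strictly positive and grows linearly in m: e_a^T V_N e_s ≥ ε (m · exp(−C_K)/2 − n_tot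 · exp(C_V)/(n − 1)) > 0; i.e., e_a^T V_N e_s ≥ m c₁ ε for some c₁ > 0. -/

import Mathlib

/-- The softmax function: `σ(x)_i = exp(x_i) / ∑_j exp(x_j)`. -/
noncomputable def softmax {d : ℕ} (x : Fin d → ℝ) : Fin d → ℝ :=
  fun i => Real.exp (x i) / ∑ j, Real.exp (x j)

/-- The standard basis vector `e_t ∈ ℝ^n`. -/
def e (n : ℕ) (t : Fin n) : Fin n → ℝ := Pi.single t 1

/-- Matrix-vector product `V x`. -/
def mv {n : ℕ} (V : Fin n → Fin n → ℝ) (x : Fin n → ℝ) : Fin n → ℝ :=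
  fun i => ∑ j, V i j * x j

/-- Dot product of two vectors. -/
def dot {n : ℕ} (u w : Fin n → ℝ) : ℝ := ∑ i, u i * w i

/-- Outer product `u v^T`. -/
def outer {n : ℕ} (u w : Fin n → ℝ) : Fin n → Fin n → ℝ := fun i j => u i * w j

/-- Attention weights of the one-layer transformer with key-query matrix `W` on input `(s, r)`:
`σ((e_s^T W e_r, e_r^T W e_r))`; component `0` is the attention on the subject token `s`,
component `1` the attention on the relation/prompt token `r`. -/
noncomputable def att {n : ℕ} (W : Fin n → Fin n → ℝ) (s r : Fin n) : Fin 2 → ℝ :=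
  softmax ![mv W (e n r) s, mv W (e n r) r]

/-- Pre-softmax output `Z(s,r) = Att_s • (V e_s) + Att_r • (V e_r)` of the one-layer
transformer with value matrix `V` and key-query matrix `W`. -/
noncomputable def Zout {n : ℕ} (V W : Fin n → Fin n → ℝ) (s r : Fin n) : Fin n → ℝ :=
  att W s r 0 • mv V (e n s) + att W s r 1 • mv V (e n r)

/-- Model output `f(s,r) = σ(Z(s,r))`. -/
noncomputable def outF {n : ℕ} (V W : Fin n → Fin n → ℝ) (s r : Fin n) : Fin n → ℝ :=
  softmax (Zout V W s r)

theorem mv_e {n : ℕ} (V : Fin n → Fin n → ℝ) (t i : Fin n) : mv V (e n t) i = V i t := by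
  simp [mv, e, Pi.single_apply]

theorem att_sum {n : ℕ} (W : Fin n → Fin n → ℝ) (s r : Fin n) :
    att W s r 0 + att W s r 1 = 1 ∧ 0 < att W s r 0 ∧ 0 < att W s r 1 := by
  simp only [att, softmax, Fin.sum_univ_two, Matrix.cons_val_zero, Matrix.cons_val_one]
  have h0 := Real.exp_pos (mv W (e n r) s)
  have h1 := Real.exp_pos (mv W (e n r) r)
  refine ⟨?_, by positivity, by positivity⟩
  field_simp

theorem att_lower {n : ℕ} (W : Fin n → Fin n → ℝ) (s r : Fin n) (CK : ℝ) (hCK : 0 < CK)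
    (h0 : |mv W (e n r) s| ≤ CK / 2) (h1 : |mv W (e n r) r| ≤ CK / 2) :
    Real.exp (-CK) / 2 ≤ att W s r 0 := by
  simp only [att, softmax, Fin.sum_univ_two, Matrix.cons_val_zero, Matrix.cons_val_one]
  rw [abs_le] at h0 h1
  generalize mv W (e n r) s = x at *
  generalize mv W (e n r) r = y at *
  have hx := Real.exp_pos x
  have hy := Real.exp_pos y
  rw [div_le_div_iff₀ (by norm_num) (by positivity)]
  have e1 : Real.exp (-CK) * Real.exp x ≤ Real.exp x := by
    rw [← Real.exp_add]; exact Real.exp_le_exp.2 (by linarith)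
  have e2 : Real.exp (-CK) * Real.exp y ≤ Real.exp x := by
    rw [← Real.exp_add]; exact Real.exp_le_exp.2 (by linarith)
  linarith

theorem outF_bound {n : ℕ} (hn : 2 ≤ n) (V W : Fin n → Fin n → ℝ) (s r : Fin n) (CV : ℝ)
    (h : ∀ t i : Fin n, |mv V (e n t) i| ≤ CV / 2) (i : Fin n) :
    0 ≤ outF V W s r i ∧ outF V W s r i ≤ Real.exp CV / ((n : ℝ) - 1) := by
  have hn' : (2 : ℝ) ≤ n := by exact_mod_cast hn
  have hZ : ∀ j, |Zout V W s r j| ≤ CV / 2 := by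
    intro j
    obtain ⟨hs, hp0, hp1⟩ := att_sum W s r
    have a0 := abs_le.1 (h s j)
    have a1 := abs_le.1 (h r j)
    simp only [Zout, Pi.add_apply, Pi.smul_apply, smul_eq_mul]
    have hb : att W s r 1 = 1 - att W s r 0 := by linarith
    rw [abs_le]
    constructor
    · have := mul_le_mul_of_nonneg_left a0.1 hp0.le
      have := mul_le_mul_of_nonneg_left a1.1 hp1.le
      rw [hb] at *
      linarith
    · have := mul_le_mul_of_nonneg_left a0.2 hp0.le
      have := mul_le_mul_of_nonneg_left a1.2 hp1.le
      rw [hb] at *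
      linarith
  have hsum : (n : ℝ) * Real.exp (-(CV / 2)) ≤ ∑ j, Real.exp (Zout V W s r j) := by
    have := Finset.card_nsmul_le_sum (Finset.univ : Finset (Fin n))
      (fun j => Real.exp (Zout V W s r j)) (Real.exp (-(CV / 2)))
      (fun j _ => Real.exp_le_exp.2 (abs_le.1 (hZ j)).1)
    simpa using this
  have hnum : Real.exp (Zout V W s r i) ≤ Real.exp (CV / 2) :=
    Real.exp_le_exp.2 (abs_le.1 (hZ i)).2
  have hpos : 0 < (n : ℝ) * Real.exp (-(CV / 2)) := by positivity
  simp only [outF, softmax]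
  refine ⟨by positivity, ?_⟩
  rw [div_le_div_iff₀ (by linarith) (by linarith)]
  have e1 : Real.exp CV * Real.exp (-(CV / 2)) = Real.exp (CV / 2) := by
    rw [← Real.exp_add]; congr 1; ring
  have e2 := mul_le_mul_of_nonneg_left hsum (Real.exp_pos CV).le
  have e3 : Real.exp CV * (n * Real.exp (-(CV / 2))) = n * Real.exp (CV / 2) := by
    rw [← e1]; ring
  have e4 : Real.exp (Zout V W s r i) * ((n : ℝ) - 1) ≤ Real.exp (CV / 2) * ((n : ℝ) - 1) :=
    mul_le_mul_of_nonneg_right hnum (by linarith)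
  have := Real.exp_pos (CV / 2)
  linarith

/-- Lower bound on fact salience after one epoch of pretraining. Under the
same SGD dynamics as Statement 11, for distinct tokens `s, r, a` such that `s` never
occurs as a relation or answer token and every occurrence of the pair `(s, r)` has answer
`a`, if the pair `(s, r)` occurs `m ≥ 1` times and `s` occurs
`n_tot < m · exp(−C_K)(n − 1)/(2 exp(C_V))` times, then the fact salience after training
is at least `ε (m · exp(−C_K)/2 − n_tot · exp(C_V)/(n − 1)) > 0`; i.e.
`e_a^T V_N e_s ≥ m c₁ ε` for some `c₁ > 0`. -/
theorem fact_salience_lower_bound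
    (n : ℕ) (hn : 2 ≤ n)
    (ε CK CV : ℝ) (hε : 0 < ε) (hCK : 0 < CK) (hCV : 0 < CV)
    (N : ℕ)
    (u v a : ℕ → Fin n)
    (W : ℕ → Fin n → Fin n → ℝ)
    (hWbnd : ∀ k < N, |mv (W k) (e n (v k)) (u k)| ≤ CK / 2 ∧
      |mv (W k) (e n (v k)) (v k)| ≤ CK / 2)
    (V : ℕ → Fin n → Fin n → ℝ)
    (hV0 : V 0 = 0)
    (hVrec : ∀ k < N, V (k + 1) = V k + ε •
      (att (W k) (u k) (v k) 0 •
          outer (e n (a k) - outF (V k) (W k) (u k) (v k)) (e n (u k)) +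
        att (W k) (u k) (v k) 1 •
          outer (e n (a k) - outF (V k) (W k) (u k) (v k)) (e n (v k))))
    (hVbnd : ∀ k ≤ N, ∀ t : Fin n, ∀ i, |mv (V k) (e n t) i| ≤ CV / 2)
    (s r aa : Fin n) (hsr : s ≠ r) (hsa : s ≠ aa) (hra : r ≠ aa)
    (hsv : ∀ k < N, s ≠ v k) (hsa' : ∀ k < N, s ≠ a k)
    (hconsistent : ∀ k < N, u k = s → v k = r → a k = aa)
    (m ntot : ℕ)
    (hm : m = ((Finset.range N).filter fun k => u k = s ∧ v k = r).card)
    (hm1 : 1 ≤ m)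
    (hntot : ntot = ((Finset.range N).filter fun k => u k = s).card)
    (hsmall : (ntot : ℝ) < (m : ℝ) * Real.exp (-CK) * ((n : ℝ) - 1) / (2 * Real.exp CV)) :
    mv (V N) (e n s) aa ≥
        ε * ((m : ℝ) * Real.exp (-CK) / 2 - (ntot : ℝ) * Real.exp CV / ((n : ℝ) - 1)) ∧
      0 < ε * ((m : ℝ) * Real.exp (-CK) / 2 - (ntot : ℝ) * Real.exp CV / ((n : ℝ) - 1)) ∧
      ∃ c₁ : ℝ, 0 < c₁ ∧ mv (V N) (e n s) aa ≥ (m : ℝ) * c₁ * ε := by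
  have hn' : (2 : ℝ) ≤ n := by exact_mod_cast hn
  have key : ∀ K ≤ N, ε * ((((Finset.range K).filter fun k => u k = s ∧ v k = r).card : ℝ)
      * (Real.exp (-CK) / 2) - (((Finset.range K).filter fun k => u k = s).card : ℝ) *
        (Real.exp CV / ((n : ℝ) - 1))) ≤ V K aa s := by
    intro K
    induction K with
    | zero => intro _; simp [hV0]
    | succ k ih =>
      intro hk
      have hkN : k < N := hk
      have ih := ih hkN.le
      obtain ⟨hs, hp0, hp1⟩ := att_sum (W k) (u k) (v k)
      have hal := att_lower (W k) (u k) (v k) CK hCK (hWbnd k hkN).1 (hWbnd k hkN).2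
      obtain ⟨hf0, hf1⟩ := outF_bound hn (V k) (W k) (u k) (v k) CV (hVbnd k hkN.le) aa
      have hsvk := hsv k hkN
      have hc := hconsistent k hkN
      rw [hVrec k hkN, Finset.range_add_one, Finset.filter_insert, Finset.filter_insert]
      simp only [Pi.add_apply, Pi.smul_apply, smul_eq_mul, outer, Pi.sub_apply]
      generalize outF (V k) (W k) (u k) (v k) aa = f at *
      generalize att (W k) (u k) (v k) 0 = α at *
      generalize att (W k) (u k) (v k) 1 = β at *
      generalize Real.exp CV / ((n : ℝ) - 1) = D at *
      generalize Real.exp (-CK) / 2 = C at *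
      have ev : e n (v k) s = 0 := by simp [e, Pi.single_apply, hsvk]
      rw [ev]
      have hαf : α * f ≤ D := by nlinarith
      by_cases hu : u k = s
      · have eu : e n (u k) s = 1 := by simp [e, hu]
        rw [eu]
        by_cases hv : v k = r
        · have ea : e n (a k) aa = 1 := by simp [e, hc hu hv]
          rw [ea, if_pos ⟨hu, hv⟩, if_pos hu, Finset.card_insert_of_notMem (by simp),
            Finset.card_insert_of_notMem (by simp)]
          push_cast
          have : ε * (C - D) ≤ ε * (α - α * f) :=
            mul_le_mul_of_nonneg_left (by linarith) hε.le
          linarith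
        · have ea : 0 ≤ e n (a k) aa := by
            simp only [e, Pi.single_apply]; split_ifs <;> norm_num
          rw [if_neg (by tauto), if_pos hu, Finset.card_insert_of_notMem (by simp)]
          push_cast
          have h1 := mul_nonneg hp0.le ea
          have : ε * (- D) ≤ ε * (α * e n (a k) aa - α * f) :=
            mul_le_mul_of_nonneg_left (by linarith) hε.le
          linarith
      · have eu : e n (u k) s = 0 := by simp [e, Pi.single_apply, Ne.symm hu]
        rw [eu, if_neg (by tauto), if_neg hu]
        linarith
  have h1 : mv (V N) (e n s) aa ≥
      ε * ((m : ℝ) * Real.exp (-CK) / 2 - (ntot : ℝ) * Real.exp CV / ((n : ℝ) - 1)) := by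
    rw [mv_e, ge_iff_le, mul_div_assoc, mul_div_assoc, hm, hntot]
    exact key N le_rfl
  have h2 : 0 < ε * ((m : ℝ) * Real.exp (-CK) / 2 -
      (ntot : ℝ) * Real.exp CV / ((n : ℝ) - 1)) := by
    apply mul_pos hε
    rw [sub_pos, div_lt_div_iff₀ (by linarith) (by norm_num)]
    rw [lt_div_iff₀ (by positivity)] at hsmall
    linarith
  have hmpos : (0 : ℝ) < m := by exact_mod_cast hm1
  refine ⟨h1, h2, ((m : ℝ) * Real.exp (-CK) / 2 -
      (ntot : ℝ) * Real.exp CV / ((n : ℝ) - 1)) / m, ?_, ?_⟩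
  · exact div_pos (pos_of_mul_pos_right h2 hε.le) hmpos
  · rw [mul_div_cancel₀ _ hmpos.ne', mul_comm]
    exact h1
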